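/- arXiv:2601.00144 — 4 statements merged into one kernel-verified Lean document; each statement's English description precedes it below -/
import Mathlib

section
/- Let n ≥ r ≥ 2 and let k be an integer with k > (1 − 1/(4(r−1)))·r!. Then every n-vertex (r,k)-tournament contains a spanning directed tight path, i.e., a directed tight path on all n vertices. -/
/-- An `(r,k)`-tournament on vertex set `Fin n`: every edge is an injective
`r`-tuple of vertices, and for every `r`-element set of vertices exactly `k`
of its orderings are edges. -/
def IsRKTournament (r k n : ℕ) (E : Set (Fin r → Fin n)) : Prop :=
  (∀ e ∈ E, Function.Injective e) ∧
  ∀ S : Finset (Fin n), S.card = r →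
    {e | e ∈ E ∧ ∀ i, e i ∈ S}.ncard = k

/-- `v` is a directed tight path sequence in the `r`-digraph with edge set `E`:
its entries are distinct and every `r` consecutive entries form an edge. -/
def IsTightPathSeq {r n s : ℕ} (E : Set (Fin r → Fin n)) (v : Fin s → Fin n) : Prop :=
  Function.Injective v ∧
  ∀ j : ℕ, ∀ h : j + r ≤ s,
    (fun i : Fin r => v ⟨j + i.1, by have := i.isLt; omega⟩) ∈ E

/-- The `r`-digraph with edge set `E` contains a directed tight path on `s` vertices. -/
def HasTightPath (r : ℕ) {n : ℕ} (E : Set (Fin r → Fin n)) (s : ℕ) : Prop :=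
  ∃ v : Fin s → Fin n, IsTightPathSeq E v

open scoped Finset

/-- A sequence that starts positive and loses at each step at most a `1 / (4 d)` fraction of its
value `d` steps earlier stays positive. -/
theorem pos_of_delayed_recurrence (a : ℕ → ℚ) (p : ℚ) (d M : ℕ) (hd : 1 ≤ d) (hp : 0 ≤ p)
    (hpd : p * (4 * d) ≤ 1) (h0 : 0 < a 0)
    (hstep : ∀ j < M, a j - p * a (j - d) ≤ a (j + 1)) : 0 < a M := by
  have hd' : (1 : ℚ) ≤ d := by exact_mod_cast hd
  obtain ⟨x, hx⟩ : ∃ x : ℚ, x * (2 * d) = 1 := ⟨1 / (2 * d), by field_simp⟩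
  have hx0 : 0 < x := by
    by_contra! h
    nlinarith
  have hx1 : x ≤ 1 / 2 := by nlinarith
  have hpx : 2 * p ≤ x := by
    by_contra! h
    nlinarith
  suffices key : ∀ j ≤ M, (∀ i ≤ j, 0 < a i) ∧ ∀ i ≤ d, (1 - i * x) * a (j - i) ≤ a j from
    (key M le_rfl).1 M le_rfl
  intro j
  induction j with
  | zero =>
    refine fun _ => ⟨fun i hi => by simpa [Nat.le_zero.mp hi] using h0, fun i _ => ?_⟩
    have : 0 ≤ (i : ℚ) * x := by positivity
    simp only [Nat.zero_sub]
    nlinarith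
  | succ j ih =>
    intro hj
    obtain ⟨hpos, hratio⟩ := ih (by omega)
    have hj0 := hpos j le_rfl
    have hlast : a (j - d) ≤ 2 * a j := by
      have := hratio d le_rfl
      have hdx : (d : ℚ) * x = 1 / 2 := by linarith
      rw [hdx] at this
      linarith
    have hnext : (1 - x) * a j ≤ a (j + 1) := by
      have := hstep j (by omega)
      nlinarith [mul_le_mul_of_nonneg_left hlast hp]
    have hnext0 : 0 < a (j + 1) := by nlinarith
    refine ⟨fun i hi => ?_, fun i hi => ?_⟩
    · rcases Nat.lt_or_ge i (j + 1) with h | h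
      · exact hpos i (by omega)
      · rwa [le_antisymm hi h]
    · cases i with
      | zero => simp
      | succ i =>
        have hi' := hratio i (by omega)
        have hai := hpos (j - i) (by omega)
        rw [Nat.add_sub_add_right]
        push_cast
        have h1 := mul_le_mul_of_nonneg_left hi' (by linarith : 0 ≤ 1 - x)
        have h2 : 0 ≤ (i : ℚ) * x * x * a (j - i) := by positivity
        nlinarith

/-- The window of length `r` starting at position `j` in a sequence `v` of length `n`. -/
def window {α : Type*} {r n : ℕ} (v : Fin n → α) (j : ℕ) (h : j + r ≤ n) : Fin r → α :=
  fun i => v ⟨j + i.1, by have := i.isLt; omega⟩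

theorem window_injective {α : Type*} {r n : ℕ} {v : Fin n → α} (hv : Function.Injective v)
    (j : ℕ) (h : j + r ≤ n) : Function.Injective (window v j h) := by
  intro a b hab
  have := congrArg Fin.val (hv hab)
  ext
  simpa using this

/-- The permutation of `Fin n` acting as `τ` on the window of length `r` starting at `j`. -/
noncomputable def windowPerm {r n : ℕ} (j : ℕ) (h : j + r ≤ n) (τ : Equiv.Perm (Fin r)) :
    Equiv.Perm (Fin n) :=
  τ.viaFintypeEmbedding ⟨window id j h, window_injective Function.injective_id j h⟩

theorem window_comp_windowPerm {α : Type*} {r n : ℕ} (v : Fin n → α) (j : ℕ) (h : j + r ≤ n)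
    (τ : Equiv.Perm (Fin r)) : window (v ∘ windowPerm j h τ) j h = window v j h ∘ τ := by
  funext i
  exact congrArg v (Equiv.Perm.viaFintypeEmbedding_apply_image τ
    ⟨window id j h, window_injective Function.injective_id j h⟩ i)

theorem window_comp_windowPerm_of_le {α : Type*} {r n : ℕ} (v : Fin n → α) (j : ℕ)
    (h : j + r ≤ n) (τ : Equiv.Perm (Fin r)) (i : ℕ) (hi : i + r ≤ n) (hij : i + r ≤ j) :
    window (v ∘ windowPerm j h τ) i hi = window v i hi := by
  funext t
  refine congrArg v (Equiv.Perm.viaFintypeEmbedding_apply_notMem_range τ _ ?_)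
  rintro ⟨s, hs⟩
  have := congrArg Fin.val hs
  simp [window] at this
  omega

theorem IsRKTournament.ncard_comp_perm {r k n : ℕ} {E : Set (Fin r → Fin n)}
    (hT : IsRKTournament r k n E) {w : Fin r → Fin n} (hw : Function.Injective w) :
    {τ : Equiv.Perm (Fin r) | w ∘ τ ∈ E}.ncard = k := by
  rw [← hT.2 (Finset.univ.map ⟨w, hw⟩) (by simp),
    ← Set.ncard_image_of_injective (f := fun τ : Equiv.Perm (Fin r) => w ∘ τ)]
  · congr 1
    ext e
    constructor
    · rintro ⟨τ, hτ, rfl⟩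
      exact ⟨hτ, by simp⟩
    · rintro ⟨he, heS⟩
      have hmem : ∀ i, ∃ t, w t = e i := by simpa using heS
      choose g hg using hmem
      have hginj : Function.Injective g := fun a b hab =>
        hT.1 e he (by rw [← hg a, ← hg b, hab])
      refine ⟨Equiv.ofBijective g (Finite.injective_iff_bijective.mp hginj), ?_, funext hg⟩
      have : w ∘ g = e := funext hg
      simpa [this] using he
  · intro σ τ h
    ext i
    exact congrArg Fin.val (hw (congrFun h i))

open Classical in
/-- The permutations of `Fin n` whose first `j` windows of length `r` all lie in `E`. -/
noncomputable def goodPerms {r n : ℕ} (E : Set (Fin r → Fin n)) (j : ℕ) :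
    Finset (Equiv.Perm (Fin n)) :=
  {σ | ∀ i < j, ∀ h : i + r ≤ n, window σ i h ∈ E}

open Classical in
/-- The permutations of `Fin n` whose `j`-th window of length `r` is not in `E`, while all windows
preceding and disjoint from it are. -/
noncomputable def badPerms {r n : ℕ} (E : Set (Fin r → Fin n)) (j : ℕ) (h : j + r ≤ n) :
    Finset (Equiv.Perm (Fin n)) :=
  (goodPerms E (j - (r - 1))).filter fun σ => window σ j h ∉ E

open Classical in
/-- Given that the windows disjoint from and preceding the `j`-th one are edges, the `j`-th window
fails to be an edge for exactly a `1 - k / r!` fraction of the permutations. -/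
theorem IsRKTournament.card_bad_window {r k n : ℕ} {E : Set (Fin r → Fin n)}
    (hT : IsRKTournament r k n E) (j : ℕ) (h : j + r ≤ n) :
    r.factorial * #(badPerms E j h) =
      (r.factorial - k) * #(goodPerms E (j - (r - 1))) := by
  set G := goodPerms E (j - (r - 1)) with hG
  have hinv : ∀ (τ : Equiv.Perm (Fin r)) σ, σ * windowPerm j h τ ∈ G ↔ σ ∈ G := by
    intro τ σ
    simp only [hG, goodPerms, Finset.mem_filter, Finset.mem_univ, true_and, Equiv.Perm.coe_mul]
    refine forall₂_congr fun i hi => forall_congr' fun hin => ?_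
    rw [window_comp_windowPerm_of_le _ _ _ _ _ _ (by omega)]
  have hcount : ∀ σ ∈ G, #{τ : Equiv.Perm (Fin r) | window σ j h ∘ τ ∉ E} = r.factorial - k := by
    intro σ _
    have h1 := hT.ncard_comp_perm (window_injective σ.injective j h)
    rw [Set.ncard_eq_toFinset_card', Set.toFinset_ofPred] at h1
    have h2 := Finset.card_filter_add_card_filter_not (s := Finset.univ)
      (fun τ : Equiv.Perm (Fin r) => window σ j h ∘ τ ∈ E)
    rw [Finset.card_univ, Fintype.card_perm, Fintype.card_fin] at h2
    omega
  have hbad : ∀ τ : Equiv.Perm (Fin r),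
      #(G.filter fun σ : Equiv.Perm (Fin n) => window σ j h ∘ τ ∉ E) = #(badPerms E j h) := by
    intro τ
    refine Finset.card_equiv (Equiv.mulRight (windowPerm j h τ)) fun σ => ?_
    rw [badPerms, Finset.mem_filter, Finset.mem_filter, Equiv.coe_mulRight, hinv, Equiv.Perm.coe_mul,
      window_comp_windowPerm]
  have hswap := Finset.sum_card_bipartiteAbove_eq_sum_card_bipartiteBelow
    (s := G) (t := Finset.univ)
    (fun (σ : Equiv.Perm (Fin n)) (τ : Equiv.Perm (Fin r)) => window σ j h ∘ τ ∉ E)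
  simp only [Finset.bipartiteAbove, Finset.bipartiteBelow] at hswap
  rw [Finset.sum_congr rfl hcount, Finset.sum_congr rfl fun τ _ => hbad τ] at hswap
  simp only [Finset.sum_const, Finset.card_univ, Fintype.card_perm, Fintype.card_fin,
    smul_eq_mul] at hswap
  rw [← hswap, mul_comm]

theorem card_goodPerms_zero {r n : ℕ} (E : Set (Fin r → Fin n)) :
    0 < #(goodPerms E 0) :=
  Finset.card_pos.mpr ⟨1, by simp [goodPerms]⟩

open Classical in
theorem card_goodPerms_le {r n : ℕ} (E : Set (Fin r → Fin n)) (j : ℕ) (h : j + r ≤ n) :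
    #(goodPerms E j) ≤ #(goodPerms E (j + 1)) +
      #(badPerms E j h) := by
  refine (Finset.card_le_card fun σ hσ => ?_).trans (Finset.card_union_le _ _)
  simp only [goodPerms, badPerms, Finset.mem_union, Finset.mem_filter, Finset.mem_univ, true_and] at hσ ⊢
  by_cases hw : window σ j h ∈ E
  · refine Or.inl fun i hi hin => ?_
    rcases Nat.lt_succ_iff_lt_or_eq.mp hi with hij | rfl
    · exact hσ i hij hin
    · exact hw
  · exact Or.inr ⟨fun i hi => hσ i (by omega), hw⟩

/-- Theorem: if `n ≥ r ≥ 2` and `k > (1 − 1/(4(r−1)))·r!`, then every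
`n`-vertex `(r,k)`-tournament contains a spanning tight path. -/
theorem stmt13 (r n k : ℕ) (hr : 2 ≤ r) (hn : r ≤ n)
    (hk : (1 - 1 / (4 * ((r : ℚ) - 1))) * (r.factorial : ℚ) < (k : ℚ))
    (E : Set (Fin r → Fin n)) (hT : IsRKTournament r k n E) :
    HasTightPath r E n := by
  classical
  have hle : k ≤ r.factorial := by
    rw [← hT.ncard_comp_perm (window_injective (v := id) Function.injective_id 0 (by omega)),
      Set.ncard_eq_toFinset_card']
    exact (Finset.card_le_univ _).trans_eq (by simp [Fintype.card_perm])
  have hf : (0 : ℚ) < r.factorial := by exact_mod_cast r.factorial_pos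
  have hr1 : (1 : ℚ) ≤ (r : ℚ) - 1 := by
    have : (2 : ℚ) ≤ r := by exact_mod_cast hr
    linarith
  have hpos := pos_of_delayed_recurrence (fun j => (#(goodPerms E j) : ℚ))
    ((r.factorial - k) / r.factorial) (r - 1) (n - r + 1) (by omega)
    (div_nonneg (sub_nonneg.mpr (by exact_mod_cast hle)) hf.le) ?_
    (by exact_mod_cast card_goodPerms_zero E) ?_
  · obtain ⟨σ, hσ⟩ := Finset.card_pos.mp (by exact_mod_cast hpos : 0 < #(goodPerms E (n - r + 1)))
    simp only [goodPerms, Finset.mem_filter, Finset.mem_univ, true_and] at hσ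
    exact ⟨σ, σ.injective, fun j h => hσ j (by omega) h⟩
  · push_cast [Nat.cast_sub (by omega : 1 ≤ r)]
    rw [div_mul_eq_mul_div, div_le_one hf]
    have : 1 / (4 * ((r : ℚ) - 1)) * (4 * ((r : ℚ) - 1)) = 1 := by
      field_simp
    nlinarith
  · intro j hj
    have h : j + r ≤ n := by omega
    have h1 : (#(goodPerms E j) : ℚ) ≤ #(goodPerms E (j + 1)) +
        #(badPerms E j h) := by
      exact_mod_cast card_goodPerms_le E j h
    have h2 : (r.factorial : ℚ) * #(badPerms E j h) =
        (r.factorial - k) * #(goodPerms E (j - (r - 1))) := by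
      rw [← Nat.cast_sub hle]
      exact_mod_cast hT.card_bad_window j h
    rw [div_mul_eq_mul_div, ← h2, mul_div_cancel_left₀ _ hf.ne']
    linarith
end

section
/- Every n-vertex (3,5)-tournament with n ≥ 3 contains a spanning directed tight path, i.e., a directed tight path on all n vertices. -/
/-- Every three consecutive entries of the list satisfy the ternary relation `R`. -/
def IsTightList {α : Type*} (R : α → α → α → Prop) : List α → Prop
  | a :: b :: c :: t => R a b c ∧ IsTightList R (b :: c :: t)
  | _ => True

theorem IsTightList.getElem {α : Type*} {R : α → α → α → Prop} {l : List α}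
    (h : IsTightList R l) (j : ℕ) (hj : j + 2 < l.length) : R l[j] l[j + 1] l[j + 2] := by
  induction l generalizing j with
  | nil => simp at hj
  | cons a l ih =>
    match l, h, j with
    | [], _, _ => simp at hj
    | [_], _, _ => simp at hj
    | _ :: _ :: _, h, 0 => exact h.1
    | _ :: _ :: _, h, j + 1 => exact ih h.2 j (by simpa using hj)

/-- If `x` cannot be put in front of a tight list, it can be inserted later on. -/
theorem IsTightList.exists_insert_of_not {α : Type*} {R : α → α → α → Prop}
    (hR : ∀ x a b, x ≠ a → x ≠ b → a ≠ b → ¬ R x a b → R a x b ∧ R a b x)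
    (x : α) (t : List α) (a b : α) (hnd : (x :: a :: b :: t).Nodup)
    (h : IsTightList R (a :: b :: t)) (hx : ¬ R x a b) :
    ∃ c t', (c = x ∨ c = b) ∧ (a :: c :: t').Perm (x :: a :: b :: t) ∧
      IsTightList R (a :: c :: t') := by
  induction t generalizing a b with
  | nil =>
    obtain ⟨-, h₂⟩ := hR x a b (by grind) (by grind) (by grind) hx
    exact ⟨b, [x], .inr rfl, List.perm_append_comm (l₁ := [a, b]) (l₂ := [x]), h₂, trivial⟩
  | cons d t ih =>
    obtain ⟨h₁, h₂⟩ := hR x a b (by grind) (by grind) (by grind) hx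
    by_cases hd : R x b d
    · exact ⟨x, b :: d :: t, .inl rfl, .swap _ _ _, h₁, hd, h.2⟩
    · obtain ⟨c, t', hc, hp, ht⟩ := ih b d (by grind) h.2 hd
      refine ⟨b, c :: t', .inr rfl, (hp.cons a).trans (.swap _ _ _), ?_, ht⟩
      rcases hc with rfl | rfl
      · exact h₂
      · exact h.1

theorem exists_perm_isTightList {α : Type*} {R : α → α → α → Prop}
    (hR : ∀ x a b, x ≠ a → x ≠ b → a ≠ b → ¬ R x a b → R a x b ∧ R a b x)
    (l : List α) (hl : l.Nodup) : ∃ l', l'.Perm l ∧ IsTightList R l' := by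
  induction l with
  | nil => exact ⟨[], .refl _, trivial⟩
  | cons x l ih =>
    obtain ⟨l', hp, ht⟩ := ih hl.of_cons
    have hnd : (x :: l').Nodup := (hp.cons x).nodup_iff.2 hl
    match l', hp, ht, hnd with
    | [], hp, _, _ => exact ⟨[x], hp.cons x, trivial⟩
    | [a], hp, _, _ => exact ⟨[x, a], hp.cons x, trivial⟩
    | a :: b :: t, hp, ht, hnd =>
      by_cases hx : R x a b
      · exact ⟨x :: a :: b :: t, hp.cons x, hx, ht⟩
      · obtain ⟨c, t', -, hp', ht'⟩ := ht.exists_insert_of_not hR x t a b hnd hx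
        exact ⟨a :: c :: t', hp'.trans (hp.cons x), ht'⟩

theorem IsRKTournament.mem_of_notMem {n : ℕ} {E : Set (Fin 3 → Fin n)}
    (hT : IsRKTournament 3 5 n E) (x a b : Fin n) (hxa : x ≠ a) (hxb : x ≠ b) (hab : a ≠ b)
    (hx : ![x, a, b] ∉ E) : ![a, x, b] ∈ E ∧ ![a, b, x] ∈ E := by
  have hcard := hT.2 {x, a, b} (Finset.card_eq_three.2 ⟨x, a, b, hxa, hxb, hab, rfl⟩)
  have key : ∀ e ∈ E, (∀ i, e i ∈ ({x, a, b} : Finset (Fin n))) →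
      e = ![x, b, a] ∨ e = ![b, x, a] ∨ e = ![b, a, x] ∨ e = ![a, x, b] ∨ e = ![a, b, x] := by
    intro e he hS
    have hinj := hT.1 e he
    have h01 : e 0 ≠ e 1 := hinj.ne (by decide)
    have h02 : e 0 ≠ e 2 := hinj.ne (by decide)
    have h12 : e 1 ≠ e 2 := hinj.ne (by decide)
    have hne : e ≠ ![x, a, b] := fun h => hx (h ▸ he)
    have hS0 := hS 0
    have hS1 := hS 1
    have hS2 := hS 2
    have hext : ∀ p q r : Fin n, e = ![p, q, r] ↔ e 0 = p ∧ e 1 = q ∧ e 2 = r := by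
      intro p q r
      simp [funext_iff, Fin.forall_fin_succ]
    simp only [ne_eq, hext, Finset.mem_insert, Finset.mem_singleton] at *
    grind
  have bound : ∀ p q r s : Fin 3 → Fin n,
      ¬ {e | e ∈ E ∧ ∀ i, e i ∈ ({x, a, b} : Finset (Fin n))} ⊆ ({p, q, r, s} : Finset _) := by
    intro p q r s hsub
    have h := Set.ncard_le_ncard hsub (Finset.finite_toSet _)
    rw [hcard, Set.ncard_coe_finset] at h
    have := Finset.card_le_four (a := p) (b := q) (c := r) (d := s)
    omega
  constructor
  · by_contra hn
    refine bound ![x, b, a] ![b, x, a] ![b, a, x] ![a, b, x] fun e he => ?_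
    have hne : e ≠ ![a, x, b] := fun h => hn (h ▸ he.1)
    have := key e he.1 he.2
    simp only [Finset.coe_insert, Finset.coe_singleton, Set.mem_insert_iff, Set.mem_singleton_iff]
    tauto
  · by_contra hn
    refine bound ![x, b, a] ![b, x, a] ![b, a, x] ![a, x, b] fun e he => ?_
    have hne : e ≠ ![a, b, x] := fun h => hn (h ▸ he.1)
    have := key e he.1 he.2
    simp only [Finset.coe_insert, Finset.coe_singleton, Set.mem_insert_iff, Set.mem_singleton_iff]
    tauto

/-- Proposition: every `n`-vertex `(3,5)`-tournament with `n ≥ 3` contains a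
spanning tight path. -/
theorem stmt14 (n : ℕ) (hn : 3 ≤ n)
    (E : Set (Fin 3 → Fin n)) (hT : IsRKTournament 3 5 n E) :
    HasTightPath 3 E n := by
  obtain ⟨l, hp, ht⟩ := exists_perm_isTightList (R := fun a b c => ![a, b, c] ∈ E)
    hT.mem_of_notMem (List.finRange n) (List.nodup_finRange n)
  have hlen : l.length = n := by simpa using hp.length_eq
  have hnd : l.Nodup := hp.nodup_iff.2 (List.nodup_finRange n)
  refine ⟨fun i => l[i.1], fun i j hij => ?_, fun j hj => ?_⟩
  · exact Fin.ext ((hnd.getElem_inj_iff).1 hij)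
  · convert ht.getElem j (by omega) using 1
    ext i
    fin_cases i <;> rfl
end

section
/- Let s ≥ 1 and let G be an s²-vertex (3,4)-tournament containing no triangle. Then G contains a directed tight path on s vertices. -/
/-- A triangle in a 3-digraph: three distinct vertices `u,v,w` with all three
cyclic orderings `(u,v,w)`, `(v,w,u)`, `(w,u,v)` as edges. -/
def HasTriangle {n : ℕ} (E : Set (Fin 3 → Fin n)) : Prop :=
  ∃ u v w : Fin n, u ≠ v ∧ v ≠ w ∧ u ≠ w ∧
    ![u, v, w] ∈ E ∧ ![v, w, u] ∈ E ∧ ![w, u, v] ∈ E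

/-- The first `k` values of `f` are distinct elements of `W`, and any three consecutive ones
satisfy `T`. -/
structure TightSeq {α : Type*} (T : α → α → α → Prop) (W : Finset α) (f : ℕ → α) (k : ℕ) :
    Prop where
  mem : ∀ i < k, f i ∈ W
  inj : ∀ i < k, ∀ j < k, f i = f j → i = j
  edge : ∀ i, i + 2 < k → T (f i) (f (i + 1)) (f (i + 2))

namespace TightSeq

variable {α : Type*} {T : α → α → α → Prop} {W : Finset α} {f g : ℕ → α} {k l : ℕ}

theorem mono {W' : Finset α} (hf : TightSeq T W f k) (hW : W ⊆ W') : TightSeq T W' f k :=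
  ⟨fun i hi => hW (hf.mem i hi), hf.inj, hf.edge⟩

theorem take (hf : TightSeq T W f k) (hl : l ≤ k) : TightSeq T W f l :=
  ⟨fun i hi => hf.mem i (by omega), fun i hi j hj => hf.inj i (by omega) j (by omega),
    fun i hi => hf.edge i (by omega)⟩

theorem drop (hf : TightSeq T W f k) (d : ℕ) (hl : d + l ≤ k) :
    TightSeq T W (fun i => f (d + i)) l :=
  ⟨fun i hi => hf.mem _ (by omega),
    fun i hi j hj h => by have := hf.inj _ (by omega) _ (by omega) h; omega,
    fun i hi => hf.edge (d + i) (by omega)⟩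

theorem append (hf : TightSeq T W f k) (hg : TightSeq T W g l)
    (hfg : ∀ i < k, ∀ j < l, f i ≠ g j)
    (h₁ : ∀ i, i + 2 = k → 0 < l → T (f i) (f (i + 1)) (g 0))
    (h₂ : ∀ i, i + 1 = k → 1 < l → T (f i) (g 0) (g 1)) :
    TightSeq T W (fun i => if i < k then f i else g (i - k)) (k + l) := by
  refine ⟨fun i hi => ?_, fun i hi j hj h => ?_, fun i hi => ?_⟩
  · split_ifs with h
    · exact hf.mem i h
    · exact hg.mem _ (by omega)
  · split_ifs at h with hik hjk hjk
    · exact hf.inj i hik j hjk h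
    · exact absurd h (hfg i hik _ (by omega))
    · exact absurd h.symm (hfg j hjk _ (by omega))
    · have := hg.inj _ (by omega) _ (by omega) h
      omega
  · rcases lt_or_ge (i + 2) k with h | h
    · rw [if_pos (by omega), if_pos (by omega), if_pos h]
      exact hf.edge i h
    rcases h.eq_or_lt with h | h
    · rw [if_pos (by omega), if_pos (by omega), if_neg (by omega),
        show i + 2 - k = 0 by omega]
      exact h₁ i h.symm (by omega)
    rcases Nat.lt_or_ge i k with h' | h'
    · rw [if_pos h', if_neg (by omega), if_neg (by omega), show i + 1 - k = 0 by omega,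
        show i + 2 - k = 1 by omega]
      exact h₂ i (by omega) (by omega)
    · rw [if_neg (by omega), if_neg (by omega), if_neg (by omega),
        show i + 1 - k = i - k + 1 by omega, show i + 2 - k = i - k + 2 by omega]
      exact hg.edge _ (by omega)

/-- If at most one rotation of each triple fails `T`, two disjoint tight sequences of the same
positive length can be recombined into a longer one. -/
theorem exists_longer_of_disjoint
    (hT : ∀ a b c, a ≠ b → b ≠ c → a ≠ c → T a b c ∨ T b c a)
    (hk : 0 < k) (hf : TightSeq T W f k) (hg : TightSeq T W g k)
    (hfg : ∀ i < k, ∀ j < k, f i ≠ g j) : ∃ h, TightSeq T W h (k + 1) := by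
  by_contra hno
  push Not at hno
  have hgf : ∀ i < k, ∀ j < k, g i ≠ f j := fun i hi j hj => (hfg j hj i hi).symm
  have hne : ∀ {u : ℕ → α}, TightSeq T W u k → ∀ i, i + 1 < k → u i ≠ u (i + 1) :=
    fun hu i hi h => by have := hu.inj i (by omega) (i + 1) hi h; omega
  -- Otherwise `g 0, …, g j, f j, …` is a tight sequence of length `k + 1`.
  have key : ∀ j, j + 1 < k → ¬ T (g j) (f j) (f (j + 1)) := by
    intro j
    induction j with
    | zero =>
      intro hj h
      refine hno _ (add_comm k 1 ▸ (hg.take (l := 1) (by omega)).append hf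
        (fun i hi j hj => hgf i (by omega) j hj) (fun i hi => by omega) ?_)
      intro i hi _
      obtain rfl : i = 0 := by omega
      exact h
    | succ j ih =>
      intro hj h
      have hext : T (f j) (f (j + 1)) (g j) :=
        (hT _ _ _ (hgf j (by omega) j (by omega)) (hne hf j (by omega))
          (hgf j (by omega) _ (by omega))).resolve_left (ih (by omega))
      rcases hT (f (j + 1)) (g j) (g (j + 1)) (hfg _ (by omega) _ (by omega))
        (hne hg j (by omega)) (hfg _ (by omega) _ (by omega)) with h' | h'
      · refine hno _ (((hf.take (l := j + 2) (by omega)).append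
          (hg.drop (l := k - j) j (by omega))
          (fun a ha b hb => hfg a (by omega) _ (by omega)) ?_ ?_).take (by omega))
        · intro i hi _
          obtain rfl : i = j := by omega
          exact hext
        · intro i hi _
          obtain rfl : i = j + 1 := by omega
          exact h'
      · refine hno _ (((hg.take (l := j + 2) (by omega)).append
          (hf.drop (l := k - (j + 1)) (j + 1) (by omega))
          (fun a ha b hb => hgf a (by omega) _ (by omega)) ?_ ?_).take (by omega))
        · intro i hi _
          obtain rfl : i = j := by omega
          exact h'
        · intro i hi _
          obtain rfl : i = j + 1 := by omega
          exact h
  rcases Nat.lt_or_ge 1 k with hk1 | hk1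
  · obtain ⟨m, rfl⟩ : ∃ m, k = m + 2 := ⟨k - 2, by omega⟩
    refine hno _ (hf.append (hg.drop (l := 1) m (by omega))
      (fun a ha b hb => hfg a ha _ (by omega)) ?_ (by omega))
    intro i hi _
    obtain rfl : i = m := by omega
    exact (hT _ _ _ (hgf i (by omega) i (by omega)) (hne hf i (by omega))
      (hgf i (by omega) _ (by omega))).resolve_left (key i (by omega))
  · refine hno _ (hf.append (hg.take (l := 1) (by omega))
      (fun a ha b hb => hfg a ha _ (by omega)) (by omega) (by omega))

theorem exists_of_sq_le_card [DecidableEq α] [Nonempty α]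
    (hT : ∀ a b c, a ≠ b → b ≠ c → a ≠ c → T a b c ∨ T b c a) (k : ℕ) (W : Finset α)
    (hW : k ^ 2 ≤ W.card) : ∃ f, TightSeq T W f k := by
  induction k generalizing W with
  | zero => exact ⟨fun _ => Classical.arbitrary α, by simp, by simp, by simp⟩
  | succ k ih =>
    rcases Nat.eq_zero_or_pos k with rfl | hk
    · obtain ⟨x, hx⟩ : W.Nonempty := Finset.card_pos.mp (by omega)
      exact ⟨fun _ => x, fun _ _ => hx, by omega, by omega⟩
    have hsq : (k + 1) ^ 2 = k ^ 2 + 2 * k + 1 := by ring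
    obtain ⟨f, hf⟩ := ih W (by omega)
    obtain ⟨g, hg⟩ := ih (W \ (Finset.range k).image f) (by
      have h₁ := Finset.le_card_sdiff ((Finset.range k).image f) W
      have h₂ := Finset.card_image_le (s := Finset.range k) (f := f)
      rw [Finset.card_range] at h₂
      omega)
    refine exists_longer_of_disjoint hT hk hf (hg.mono Finset.sdiff_subset) ?_
    intro i hi j hj h
    have := (Finset.mem_sdiff.mp (hg.mem j hj)).2
    exact this (Finset.mem_image.mpr ⟨i, Finset.mem_range.mpr hi, h⟩)

end TightSeq

theorem eq_vec_of_injective_of_mem {α : Type*} {a b c : α} {e : Fin 3 → α}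
    (he : Function.Injective e) (hmem : ∀ i, e i = a ∨ e i = b ∨ e i = c) :
    e = ![a, b, c] ∨ e = ![b, c, a] ∨ e = ![c, a, b] ∨
      e = ![a, c, b] ∨ e = ![c, b, a] ∨ e = ![b, a, c] := by
  have h01 : e 0 ≠ e 1 := fun h => by simpa using he h
  have h02 : e 0 ≠ e 2 := fun h => by simpa using he h
  have h12 : e 1 ≠ e 2 := fun h => by simpa using he h
  have hvec : ∀ x y z, e 0 = x → e 1 = y → e 2 = z → e = ![x, y, z] := by
    rintro x y z rfl rfl rfl
    ext i
    fin_cases i <;> rfl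
  rcases hmem 0 with h0 | h0 | h0 <;> rcases hmem 1 with h1 | h1 | h1 <;>
    rcases hmem 2 with h2 | h2 | h2 <;>
    first
    | exact absurd (h0.trans h1.symm) h01
    | exact absurd (h0.trans h2.symm) h02
    | exact absurd (h1.trans h2.symm) h12
    | simp only [hvec _ _ _ h0 h1 h2, true_or, or_true]

/-- In a triangle-free `(3,4)`-tournament at most one rotation of a triple is a non-edge. -/
theorem IsRKTournament.mem_or_mem_rotate {n : ℕ} {E : Set (Fin 3 → Fin n)}
    (hT : IsRKTournament 3 4 n E) (htri : ¬ HasTriangle E) {a b c : Fin n}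
    (hab : a ≠ b) (hbc : b ≠ c) (hac : a ≠ c) : ![a, b, c] ∈ E ∨ ![b, c, a] ∈ E := by
  by_contra! hmiss
  obtain ⟨h₁, h₂⟩ := hmiss
  have hcard := hT.2 {a, b, c} (Finset.card_eq_three.mpr ⟨a, b, c, hab, hac, hbc, rfl⟩)
  have hcases : ∀ e, e ∈ E ∧ (∀ i, e i ∈ ({a, b, c} : Finset (Fin n))) → e = ![c, a, b] ∨
      e = ![a, c, b] ∨ e = ![c, b, a] ∨ e = ![b, a, c] := by
    rintro e ⟨he, hmem⟩
    rcases eq_vec_of_injective_of_mem (hT.1 e he) (fun i => by simpa using hmem i) with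
      rfl | rfl | h
    · exact absurd he h₁
    · exact absurd he h₂
    · exact h
  have hthree : ∀ x y z : Fin 3 → Fin n,
      ¬ ∀ e, e ∈ E ∧ (∀ i, e i ∈ ({a, b, c} : Finset (Fin n))) → e = x ∨ e = y ∨ e = z := by
    intro x y z h
    have hle := Set.ncard_le_ncard
      (s := {e | e ∈ E ∧ ∀ i, e i ∈ ({a, b, c} : Finset (Fin n))})
      (t := (({x, y, z} : Finset (Fin 3 → Fin n)) : Set (Fin 3 → Fin n)))
      (fun e he => by simpa using h e he) (Finset.finite_toSet _)
    rw [hcard, Set.ncard_coe_finset] at hle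
    have := Finset.card_le_three (a := x) (b := y) (c := z)
    omega
  refine htri ⟨a, c, b, hac, hbc.symm, hab, ?_, ?_, ?_⟩ <;> by_contra hmiss
  · refine hthree ![c, a, b] ![c, b, a] ![b, a, c] fun e he => ?_
    rcases hcases e he with h | rfl | h | h
    exacts [.inl h, absurd he.1 hmiss, .inr (.inl h), .inr (.inr h)]
  · refine hthree ![c, a, b] ![a, c, b] ![b, a, c] fun e he => ?_
    rcases hcases e he with h | h | rfl | h
    exacts [.inl h, .inr (.inl h), absurd he.1 hmiss, .inr (.inr h)]
  · refine hthree ![c, a, b] ![a, c, b] ![c, b, a] fun e he => ?_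
    rcases hcases e he with h | h | h | rfl
    exacts [.inl h, .inr (.inl h), .inr (.inr h), absurd he.1 hmiss]

/-- Lemma: for `s ≥ 1`, every `s²`-vertex `(3,4)`-tournament with no triangle
contains a tight path on `s` vertices. -/
theorem stmt16 (s : ℕ) (hs : 1 ≤ s) (E : Set (Fin 3 → Fin (s ^ 2)))
    (hT : IsRKTournament 3 4 (s ^ 2) E) (htri : ¬ HasTriangle E) :
    HasTightPath 3 E s := by
  have : Nonempty (Fin (s ^ 2)) := ⟨⟨0, by positivity⟩⟩
  obtain ⟨f, hf⟩ := TightSeq.exists_of_sq_le_card (T := fun a b c => ![a, b, c] ∈ E)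
    (fun a b c hab hbc hac => hT.mem_or_mem_rotate htri hab hbc hac) s Finset.univ (by simp)
  refine ⟨fun i => f i, fun i j h => Fin.ext (hf.inj i i.isLt j j.isLt h), fun j h => ?_⟩
  convert hf.edge j (by omega) using 1
  ext i
  fin_cases i <;> rfl
end

section
/- For every n ≥ 1 there exists an n-vertex (3,3)-tournament in which every directed tight path has at most 2·log₂ n + 6 vertices. -/
/-- The number of low-order binary digits that must be deleted to make `x` and `y` equal. -/
noncomputable def splitLevel (x y : ℕ) : ℕ := sInf {k | x / 2 ^ k = y / 2 ^ k}

theorem splitLevel_le {x y d : ℕ} (hx : x < 2 ^ d) (hy : y < 2 ^ d) : splitLevel x y ≤ d :=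
  Nat.sInf_le (by simp [Nat.div_eq_of_lt hx, Nat.div_eq_of_lt hy])

theorem div_two_pow_splitLevel (x y : ℕ) :
    x / 2 ^ splitLevel x y = y / 2 ^ splitLevel x y := by
  refine Nat.sInf_mem (s := {k | x / 2 ^ k = y / 2 ^ k}) ⟨x + y, ?_⟩
  have h : x + y < 2 ^ (x + y) := Nat.lt_two_pow_self
  simp [Nat.div_eq_of_lt (show x < 2 ^ (x + y) by omega),
    Nat.div_eq_of_lt (show y < 2 ^ (x + y) by omega)]

theorem splitLevel_pos {x y : ℕ} (h : x ≠ y) : 0 < splitLevel x y := by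
  rw [Nat.pos_iff_ne_zero]
  intro h0
  have := div_two_pow_splitLevel x y
  simp [h0, h] at this

theorem splitLevel_comm (x y : ℕ) : splitLevel x y = splitLevel y x := by
  simp only [splitLevel, eq_comm]

theorem div_two_pow_lt_of_lt_splitLevel {x y k : ℕ} (h : x < y) (hk : k < splitLevel x y) :
    x / 2 ^ k < y / 2 ^ k :=
  lt_of_le_of_ne (Nat.div_le_div_right h.le) fun h =>
    Nat.notMem_of_lt_sInf (s := {k | x / 2 ^ k = y / 2 ^ k}) hk h

theorem splitLevel_ne_of_lt {x y z : ℕ} (hxy : x < y) (hyz : y < z) :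
    splitLevel x y ≠ splitLevel y z := by
  intro h
  obtain ⟨k, hk⟩ := Nat.exists_eq_succ_of_ne_zero (splitLevel_pos hxy.ne).ne'
  have h1 := div_two_pow_splitLevel x y
  have h2 := div_two_pow_splitLevel y z
  rw [← h] at h2
  rw [hk, Nat.pow_succ, ← Nat.div_div_eq_div_mul, ← Nat.div_div_eq_div_mul] at h1 h2
  have h3 := div_two_pow_lt_of_lt_splitLevel hxy (k := k) (by omega)
  have h4 := div_two_pow_lt_of_lt_splitLevel hyz (k := k) (by omega)
  omega

/-- A triple is an edge if its middle entry is its largest one, or if it is monotone and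
its first two entries split at a lower level than its last two. -/
def splitEdge (x y z : ℕ) : Prop :=
  (x < y ∧ z < y ∧ x ≠ z) ∨
    ((x < y ∧ y < z ∨ z < y ∧ y < x) ∧ splitLevel x y < splitLevel y z)

/-- The 3-digraph on `Fin n` whose edges are given by `splitEdge`. -/
def splitDigraph (n : ℕ) : Set (Fin 3 → Fin n) :=
  {e | splitEdge (e 0) (e 1) (e 2)}

theorem setOf_splitDigraph_eq {n : ℕ} {a b c : Fin n} (hab : a < b) (hbc : b < c) :
    {e | e ∈ splitDigraph n ∧ ∀ i, e i ∈ ({a, b, c} : Set (Fin n))} =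
      {![a, c, b], ![b, c, a],
        if splitLevel a b < splitLevel b c then ![a, b, c] else ![c, b, a]} := by
  have hne := splitLevel_ne_of_lt hab hbc
  have e1 := splitLevel_comm a b
  have e2 := splitLevel_comm b c
  have hab' : (a : ℕ) < b := hab
  have hbc' : (b : ℕ) < c := hbc
  ext e
  obtain ⟨x, y, z, rfl⟩ : ∃ x y z, e = ![x, y, z] :=
    ⟨e 0, e 1, e 2, by ext i; fin_cases i <;> rfl⟩
  simp only [splitDigraph, splitEdge, Set.mem_ofPred_eq, Fin.forall_fin_succ, Set.mem_insert_iff,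
    Set.mem_singleton_iff]
  constructor
  · rintro ⟨h, hx, hy, hz, -⟩
    simp at h hx hy hz
    split_ifs <;> rcases hx with rfl | rfl | rfl <;> rcases hy with rfl | rfl | rfl <;>
      rcases hz with rfl | rfl | rfl <;> first | (simp; done) | (exfalso; omega)
  · split_ifs with hlt
    · rintro (h | h | h) <;> simp at h <;> obtain ⟨rfl, rfl, rfl⟩ := h <;> simp <;> omega
    · rintro (h | h | h) <;> simp at h <;> obtain ⟨rfl, rfl, rfl⟩ := h <;> simp <;> omega

theorem isRKTournament_splitDigraph (n : ℕ) : IsRKTournament 3 3 n (splitDigraph n) := by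
  constructor
  · intro e he i j hij
    have hv : (e i : ℕ) = e j := by rw [hij]
    simp only [splitDigraph, splitEdge, Set.mem_ofPred_eq] at he
    fin_cases i <;> fin_cases j <;> simp at hv ⊢ <;> omega
  · intro S hS
    set f := S.orderEmbOfFin hS
    have hab : f 0 < f 1 := f.strictMono (by decide)
    have hbc : f 1 < f 2 := f.strictMono (by decide)
    have hmem : ∀ x, x ∈ S ↔ x ∈ ({f 0, f 1, f 2} : Set (Fin n)) := by
      intro x
      rw [← Finset.mem_coe, ← Finset.range_orderEmbOfFin S hS, Set.mem_range]
      simp only [Fin.exists_fin_succ, Set.mem_insert_iff, Set.mem_singleton_iff,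
        eq_comm (a := x)]
      simp [f]
    simp only [hmem]
    rw [setOf_splitDigraph_eq hab hbc, Set.ncard_eq_three]
    refine ⟨_, _, _, ?_, ?_, ?_, rfl⟩
    · simp [hab.ne]
    · split_ifs <;> simp [hbc.ne, (hab.trans hbc).ne]
    · split_ifs <;> simp [hab.ne', hbc.ne, (hab.trans hbc).ne]

theorem le_of_hasTightPath_splitDigraph {n d s : ℕ} (hn : n ≤ 2 ^ d)
    (h : HasTightPath 3 (splitDigraph n) s) : s ≤ 2 * d + 1 := by
  obtain ⟨v, hinj, hv⟩ := h
  have hlt (i) : (v i : ℕ) < 2 ^ d := (v i).isLt.trans_le hn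
  have key : ∀ i, ∀ hi : i + 1 < s,
      i + 1 ≤ (if v ⟨i, by omega⟩ < v ⟨i + 1, hi⟩ then 0 else d) +
        splitLevel (v ⟨i, by omega⟩) (v ⟨i + 1, hi⟩) := by
    intro i
    induction i with
    | zero =>
      intro hi
      have hne : v ⟨0, by omega⟩ ≠ v ⟨0 + 1, hi⟩ := fun h => by simpa using hinj h
      have := splitLevel_pos (Fin.val_ne_of_ne hne)
      omega
    | succ i ih =>
      intro hi
      have h1 := ih (by omega)
      have h2 := splitLevel_le (hlt ⟨i, by omega⟩) (hlt ⟨i + 1, by omega⟩)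
      have hne : v ⟨i + 1, by omega⟩ ≠ v ⟨i + 1 + 1, hi⟩ := fun h => by simpa using hinj h
      have h3 := splitLevel_pos (Fin.val_ne_of_ne hne)
      have he : splitEdge (v ⟨i, by omega⟩) (v ⟨i + 1, by omega⟩) (v ⟨i + 1 + 1, hi⟩) :=
        hv i (by omega)
      simp only [splitEdge] at he
      simp only [Fin.lt_def] at h1 ⊢
      split_ifs at h1 ⊢ <;> omega
  by_contra! hs
  have h1 := key (s - 2) (by omega)
  have h2 := splitLevel_le (hlt ⟨s - 2, by omega⟩) (hlt ⟨s - 2 + 1, by omega⟩)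
  split_ifs at h1 <;> omega

/-- Theorem: for every `n ≥ 1` there is an `n`-vertex `(3,3)`-tournament in
which every tight path has at most `2·log₂ n + 6` vertices. -/
theorem stmt18 (n : ℕ) (hn : 1 ≤ n) :
    ∃ E : Set (Fin 3 → Fin n), IsRKTournament 3 3 n E ∧
      ∀ s : ℕ, HasTightPath 3 E s → (s : ℝ) ≤ 2 * Real.logb 2 n + 6 := by
  refine ⟨splitDigraph n, isRKTournament_splitDigraph n, fun s hs => ?_⟩
  have h1 : s ≤ 2 * (Nat.log 2 n + 1) + 1 :=
    le_of_hasTightPath_splitDigraph (Nat.lt_pow_succ_log_self one_lt_two n).le hs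
  have h2 : (Nat.log 2 n : ℝ) ≤ Real.logb 2 n := by
    simpa using Real.natLog_le_logb n 2
  have h3 : (s : ℝ) ≤ 2 * (Nat.log 2 n + 1) + 1 := by exact_mod_cast h1
  linarith
end
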